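/- Let d ≥ 3 be an integer. There exist C > 0 and r₀ ∈ (0,1], depending only on d, with the following property. For every σ > 0, every r with 0 < r ≤ min(r₀, (d−2)/(2σ)), and every integer ℓ ≥ 1, set M := (ℓ + rσ)/(ℓ − 2 + d − rσ) and a(ρ) := ρ^ℓ·(1 + M·(r/ρ)^{2ℓ+d−2}) for ρ > 0. Then ℓ·a(r)² ≤ 5·r²·a(1)·a'(1)·(1 + C·r^d). -/

import Mathlib

theorem hasDerivAt_pow_mul_one_add_div_pow_one (ℓ n : ℕ) (M r : ℝ) :
    HasDerivAt (fun ρ : ℝ => ρ ^ ℓ * (1 + M * (r / ρ) ^ n))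
      (ℓ * (1 + M * r ^ n) - n * (M * r ^ n)) 1 := by
  have hinv : HasDerivAt (fun ρ : ℝ => r / ρ) (-r) 1 := by
    simpa [div_eq_mul_inv] using (hasDerivAt_inv (one_ne_zero (α := ℝ))).const_mul r
  have h := (hasDerivAt_pow ℓ (1 : ℝ)).mul (((hinv.pow n).const_mul M).const_add 1)
  refine HasDerivAt.congr_deriv h ?_
  rcases n with _ | n
  · simp
  · simp
    ring

theorem stmt9 (d : ℕ) (hd : 3 ≤ d) :
    ∃ C r₀ : ℝ, 0 < C ∧ 0 < r₀ ∧ r₀ ≤ 1 ∧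
      ∀ σ r : ℝ, 0 < σ → 0 < r → r ≤ min r₀ (((d:ℝ) - 2) / (2 * σ)) →
      ∀ ℓ : ℕ, 1 ≤ ℓ →
      ∀ M : ℝ, M = ((ℓ:ℝ) + r * σ) / ((ℓ:ℝ) - 2 + d - r * σ) →
      ∀ a : ℝ → ℝ, a = (fun ρ : ℝ => ρ ^ ℓ * (1 + M * (r / ρ) ^ (2 * ℓ + d - 2))) →
      (ℓ:ℝ) * (a r)^2 ≤ 5 * r^2 * (a 1 * deriv a 1) * (1 + C * r ^ d) := by
  have hd3 : (3 : ℝ) ≤ d := by exact_mod_cast hd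
  refine ⟨1, 1 / (5 * d), one_pos, by positivity, ?_, ?_⟩
  · rw [div_le_one (by positivity)]
    linarith
  intro σ r hσ hr hrle ℓ hℓ M hM a ha
  have hℓ1 : (1 : ℝ) ≤ ℓ := by exact_mod_cast hℓ
  have hrd : r * d ≤ 1 / 5 := by
    have h := (le_div_iff₀ (by positivity)).1 (hrle.trans (min_le_left _ _))
    linarith
  have hrσ : r * σ ≤ ((d : ℝ) - 2) / 2 := by
    have h := (le_div_iff₀ (by positivity)).1 (hrle.trans (min_le_right _ _))
    linarith
  have hr1 : r ≤ 1 := by nlinarith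
  have hrσ0 : 0 < r * σ := mul_pos hr hσ
  have hden : 0 < (ℓ : ℝ) - 2 + d - r * σ := by linarith
  have hM0 : 0 ≤ M := hM ▸ div_nonneg (by linarith) hden.le
  have hM1 : M ≤ 1 := by
    rw [hM, div_le_one hden]
    linarith
  set n := 2 * ℓ + d - 2 with hn
  have hncast : (n : ℝ) = 2 * ℓ + d - 2 := by
    rw [hn, Nat.cast_sub (by omega)]
    push_cast
    ring
  have hx0 : 0 ≤ M * r ^ n := by positivity
  have hxr : M * r ^ n ≤ r :=
    (mul_le_of_le_one_left (by positivity) hM1).trans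
      (pow_le_of_le_one hr.le hr1 (by omega))
  have hderiv : deriv a 1 = ℓ * (1 + M * r ^ n) - n * (M * r ^ n) :=
    ha ▸ (hasDerivAt_pow_mul_one_add_div_pow_one ℓ n M r).deriv
  have har : a r = r ^ ℓ * (1 + M) := by simp [ha, hr.ne']
  have ha1 : a 1 = 1 + M * r ^ n := by simp [ha]
  have hderiv_lower : 4 * (ℓ : ℝ) ≤ 5 * deriv a 1 := by
    have hxd : M * r ^ n * d ≤ 1 / 5 :=
      (mul_le_mul_of_nonneg_right hxr (by positivity)).trans hrd
    have hfactor : ((ℓ : ℝ) + d - 2) ≤ ℓ * d := by nlinarith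
    have := mul_le_mul_of_nonneg_left hfactor hx0
    rw [hderiv, hncast]
    nlinarith
  have har_sq : (a r) ^ 2 ≤ r ^ 2 * 4 := by
    have hle : a r ≤ r * 2 := by
      rw [har]
      exact mul_le_mul (pow_le_of_le_one hr.le hr1 (by omega)) (by linarith)
        (by linarith) hr.le
    calc (a r) ^ 2 ≤ (r * 2) ^ 2 := pow_le_pow_left₀ (by rw [har]; positivity) hle 2
      _ = r ^ 2 * 4 := by ring
  have hderiv0 : 0 ≤ deriv a 1 := by linarith
  have ha1_ge : 1 ≤ a 1 := by linarith
  calc (ℓ : ℝ) * (a r) ^ 2 ≤ ℓ * (r ^ 2 * 4) := by gcongr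
    _ = r ^ 2 * (4 * ℓ) := by ring
    _ ≤ r ^ 2 * (5 * deriv a 1) := by gcongr
    _ = 5 * r ^ 2 * (1 * deriv a 1) * 1 := by ring
    _ ≤ 5 * r ^ 2 * (a 1 * deriv a 1) * (1 + 1 * r ^ d) := by
      gcongr
      linarith [pow_pos hr d]
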